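/- arXiv:2403.04129 — 3 statements merged into one kernel-verified Lean document; each statement's English description precedes it below -/
import Mathlib

section
/- Let G be a graph and let Φ(Q_G) be the additive semigroup of pairs (L, k) ∈ (E → ℕ) × ℕ such that L is a magic labeling of G of index k. Every completely fundamental element (L, k) of Φ(Q_G) has k = 1 or k = 2. If moreover G is bipartite, then every completely fundamental element of Φ(Q_G) has k = 1. -/
open Finset

/-- Sum of the labels of the edges incident to `v`. -/
def vsum {V : Type} [DecidableEq V] (E : Finset (Sym2 V)) (L : E → ℕ) (v : V) : ℕ :=
  ∑ e ∈ E.attach, if v ∈ e.1 then L e else 0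

/-- A labeling is magic if the label sum is the same at every vertex. -/
def IsMagic {V : Type} [DecidableEq V] (E : Finset (Sym2 V)) (L : E → ℕ) : Prop :=
  ∀ v w : V, vsum E L v = vsum E L w

/-- The maximum label of a labeling. -/
def maxLabel {V : Type} (E : Finset (Sym2 V)) (L : E → ℕ) : ℕ :=
  E.attach.sup L

/-- `magicCount E k` is the number of magic `k`-labelings, i.e. magic labelings
with all labels at most `k`. -/
noncomputable def magicCount {V : Type} [DecidableEq V] (E : Finset (Sym2 V)) (k : ℕ) : ℕ :=
  Set.ncard {L : E → ℕ | IsMagic E L ∧ ∀ e, L e ≤ k}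

/-- `F` is a quasipolynomial with quasiperiod `s`. -/
def IsQuasiPoly (F : ℕ → ℚ) (s : ℕ) : Prop :=
  0 < s ∧ ∃ φ : ℕ → Polynomial ℚ, ∀ t : ℕ, F t = (φ (t % s)).eval (t : ℚ)

/-- A graph is bipartite if the vertices split into a set and its complement with
every edge joining the two parts. -/
def IsBipartite {V : Type} (E : Finset (Sym2 V)) : Prop :=
  ∃ S : Set V, ∀ e ∈ E, ∃ u v : V, e = s(u, v) ∧ u ∈ S ∧ v ∉ S

/-- The semigroup `Φ(Q_G)`: pairs `(L, k)` where `L` is a magic labeling of index `k`. -/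
def PhiQ {V : Type} [DecidableEq V] (E : Finset (Sym2 V)) : Set ((E → ℕ) × ℕ) :=
  {p | ∀ v : V, vsum E p.1 v = p.2}

/-- A nonzero element `a` of an additive semigroup `Φ` is completely fundamental if
whenever `b + c = m • a` with `b, c ∈ Φ` and `m` a positive integer, both `b` and `c`
are nonnegative integer multiples of `a`. -/
def CompletelyFundamental {α : Type} [AddCommMonoid α] (Φ : Set α) (a : α) : Prop :=
  a ∈ Φ ∧ a ≠ 0 ∧ ∀ b ∈ Φ, ∀ c ∈ Φ, ∀ m : ℕ, 0 < m → b + c = m • a →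
    (∃ β : ℕ, b = β • a) ∧ (∃ γ : ℕ, c = γ • a)

/-- The label of an edge is at most the label sum at any of its endpoints. -/
theorem label_le_vsum {V : Type} [DecidableEq V] (E : Finset (Sym2 V)) (L : E → ℕ) (e : E)
    {v : V} (hv : v ∈ e.1) : L e ≤ vsum E L v := by
  have h := Finset.single_le_sum (s := E.attach)
    (f := fun e : E => if v ∈ e.1 then L e else 0) (fun _ _ => Nat.zero_le _)
    (Finset.mem_attach E e)
  simpa [vsum, hv] using h

theorem label_le_index {V : Type} [DecidableEq V] {E : Finset (Sym2 V)}
    {a : (E → ℕ) × ℕ} (ha : a ∈ PhiQ E) (e : E) : a.1 e ≤ a.2 := by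
  obtain ⟨v, hv⟩ : ∃ v, v ∈ e.1 := ⟨_, Sym2.out_fst_mem e.1⟩
  exact (label_le_vsum E a.1 e hv).trans_eq (ha v)

theorem index_pos_of_ne_zero {V : Type} [DecidableEq V] {E : Finset (Sym2 V)}
    {a : (E → ℕ) × ℕ} (ha : a ∈ PhiQ E) (h0 : a ≠ 0) : 0 < a.2 := by
  by_contra! h
  refine h0 (Prod.ext (funext fun e => ?_) (by simpa using h))
  simpa using (label_le_index ha e).trans h

/-- An element of `Φ(Q_G)` supported on the support of a completely fundamental element `a`
has index a multiple of the index of `a`. -/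
theorem index_dvd_of_support_subset {V : Type} [DecidableEq V] {E : Finset (Sym2 V)}
    {a b : (E → ℕ) × ℕ} (ha : CompletelyFundamental (PhiQ E) a) (hb : b ∈ PhiQ E)
    (hab : ∀ e, 0 < b.1 e → 0 < a.1 e) : a.2 ∣ b.2 := by
  obtain ⟨haΦ, ha0, hfund⟩ := ha
  have hk := index_pos_of_ne_zero haΦ ha0
  have hle : ∀ e, b.1 e ≤ (b.2 + 1) * a.1 e := fun e => by
    rcases Nat.eq_zero_or_pos (b.1 e) with h | h
    · simp [h]
    · have h1 := label_le_index hb e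
      have h2 := hab e h
      nlinarith
  have hle' : b.2 ≤ (b.2 + 1) * a.2 := by nlinarith
  let c : (E → ℕ) × ℕ := (fun e => (b.2 + 1) * a.1 e - b.1 e, (b.2 + 1) * a.2 - b.2)
  have hsum : b + c = (b.2 + 1) • a := by
    ext e
    · simpa [c] using Nat.add_sub_cancel' (hle e)
    · simpa [c] using Nat.add_sub_cancel' hle'
  have hc : c ∈ PhiQ E := fun v => by
    have h : vsum E b.1 v + vsum E c.1 v = (b.2 + 1) * vsum E a.1 v := by
      simp only [vsum, ← Finset.sum_add_distrib, Finset.mul_sum]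
      refine Finset.sum_congr rfl fun e _ => ?_
      split_ifs
      · exact Nat.add_sub_cancel' (hle e)
      · simp
    rw [hb v, haΦ v] at h
    change vsum E c.1 v = (b.2 + 1) * a.2 - b.2
    omega
  obtain ⟨⟨β, hβ⟩, -⟩ := hfund b hb c hc (b.2 + 1) (Nat.succ_pos _) hsum
  exact ⟨β, by rw [hβ]; simp [mul_comm]⟩

/-- The label of the pair `s(u, v)`, extended by zero outside the edge set. -/
def pairLabel {V : Type} [DecidableEq V] (E : Finset (Sym2 V)) (L : E → ℕ) (u v : V) : ℕ :=
  ∑ e ∈ E.attach, if e.1 = s(u, v) then L e else 0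

theorem pairLabel_comm {V : Type} [DecidableEq V] (E : Finset (Sym2 V)) (L : E → ℕ) (u v : V) :
    pairLabel E L u v = pairLabel E L v u := by
  simp only [pairLabel, Sym2.eq_swap]

theorem exists_edge_of_pairLabel_pos {V : Type} [DecidableEq V] {E : Finset (Sym2 V)}
    {L : E → ℕ} {u v : V} (h : 0 < pairLabel E L u v) : ∃ e : E, e.1 = s(u, v) ∧ 0 < L e := by
  obtain ⟨e, -, he⟩ := Finset.exists_ne_zero_of_sum_ne_zero h.ne'
  rw [ite_ne_right_iff] at he
  exact ⟨e, he.1, Nat.pos_of_ne_zero he.2⟩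

theorem sum_pairLabel {V : Type} [Fintype V] [DecidableEq V] (E : Finset (Sym2 V)) (L : E → ℕ)
    (v : V) : ∑ w, pairLabel E L v w = vsum E L v := by
  simp only [pairLabel, vsum]
  rw [Finset.sum_comm]
  refine Finset.sum_congr rfl fun e _ => ?_
  split_ifs with h
  · obtain ⟨w, hw⟩ := h
    rw [hw]
    simp only [Sym2.congr_right, Finset.sum_ite_eq, Finset.mem_univ, if_true]
  · refine Finset.sum_eq_zero fun w _ => if_neg fun hw => h ?_
    simp [hw]

/-- A magic labeling of positive index has a permutation of the vertices moving each vertex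
along an edge with positive label. -/
theorem exists_perm_label_pos {V : Type} [Fintype V] [DecidableEq V] {E : Finset (Sym2 V)}
    {a : (E → ℕ) × ℕ} (ha : a ∈ PhiQ E) (hk : 0 < a.2) :
    ∃ σ : Equiv.Perm V, ∀ u, ∃ e : E, e.1 = s(u, σ u) ∧ 0 < a.1 e := by
  have hrow : ∀ v, ∑ w, pairLabel E a.1 v w = a.2 := fun v => (sum_pairLabel E a.1 v).trans (ha v)
  obtain ⟨f, hf, hpos⟩ := (Finset.all_card_le_biUnion_card_iff_exists_injective
    (fun u => Finset.univ.filter fun v => 0 < pairLabel E a.1 u v)).1 fun T => by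
      set N := T.biUnion fun u => Finset.univ.filter fun v => 0 < pairLabel E a.1 u v with hN
      refine Nat.le_of_mul_le_mul_right ?_ hk
      calc #T * a.2 = ∑ u ∈ T, ∑ w, pairLabel E a.1 u w := by simp [hrow]
        _ = ∑ u ∈ T, ∑ w ∈ N, pairLabel E a.1 u w := by
          refine Finset.sum_congr rfl fun u hu => (Finset.sum_subset (Finset.subset_univ N) ?_).symm
          intro w _ hw
          by_contra h
          exact hw (Finset.mem_biUnion.2 ⟨u, hu, by simpa using Nat.pos_of_ne_zero h⟩)
        _ = ∑ w ∈ N, ∑ u ∈ T, pairLabel E a.1 w u := by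
          rw [Finset.sum_comm]
          simp only [pairLabel_comm]
        _ ≤ ∑ w ∈ N, ∑ u, pairLabel E a.1 w u :=
          Finset.sum_le_sum fun w _ => Finset.sum_le_sum_of_subset (Finset.subset_univ T)
        _ = #N * a.2 := by simp [hrow]
  refine ⟨Equiv.ofBijective f (Finite.injective_iff_bijective.1 hf), fun u => ?_⟩
  exact exists_edge_of_pairLabel_pos (by simpa using hpos u)

/-- The labeling in which each vertex `u` contributes `w u` to the edge `s(u, σ u)`. -/
def permLabel {V : Type} [Fintype V] [DecidableEq V] (E : Finset (Sym2 V)) (σ : Equiv.Perm V)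
    (w : V → ℕ) (e : E) : ℕ :=
  ∑ u, if e.1 = s(u, σ u) then w u else 0

theorem vsum_permLabel {V : Type} [Fintype V] [DecidableEq V] {E : Finset (Sym2 V)}
    {σ : Equiv.Perm V} (hσ : ∀ u, s(u, σ u) ∈ E) (w : V → ℕ) (v : V) :
    vsum E (permLabel E σ w) v = ∑ u, if v = u ∨ v = σ u then w u else 0 := by
  have h : ∀ e : E, (if v ∈ e.1 then permLabel E σ w e else 0) =
      ∑ u, if e = ⟨s(u, σ u), hσ u⟩ then (if v = u ∨ v = σ u then w u else 0) else 0 := fun e => by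
    simp only [Subtype.ext_iff]
    split_ifs with hv
    · refine Finset.sum_congr rfl fun u _ => ?_
      split_ifs with h1 h2 <;> simp_all
    · refine (Finset.sum_eq_zero fun u _ => ?_).symm
      split_ifs with h1 h2 <;> simp_all
  simp only [vsum, h]
  rw [Finset.sum_comm]
  simp

/-- The index of a completely fundamental element divides the index of every labeling
`permLabel E σ w` supported on its support. -/
theorem index_dvd_of_permLabel {V : Type} [Fintype V] [DecidableEq V] {E : Finset (Sym2 V)}
    {a : (E → ℕ) × ℕ} (ha : CompletelyFundamental (PhiQ E) a) {σ : Equiv.Perm V}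
    (hσ : ∀ u, ∃ e : E, e.1 = s(u, σ u) ∧ 0 < a.1 e) (w : V → ℕ) (n : ℕ)
    (hn : ∀ v, (∑ u, if v = u ∨ v = σ u then w u else 0) = n) : a.2 ∣ n := by
  have hmem : ∀ u, s(u, σ u) ∈ E := fun u => by
    obtain ⟨e, he, -⟩ := hσ u
    exact he ▸ e.2
  refine index_dvd_of_support_subset (b := (permLabel E σ w, n)) ha
    (fun v => (vsum_permLabel hmem w v).trans (hn v)) fun e he => ?_
  obtain ⟨u, -, hu⟩ := Finset.exists_ne_zero_of_sum_ne_zero he.ne'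
  rw [ite_ne_right_iff] at hu
  obtain ⟨e', he', hpos⟩ := hσ u
  rwa [Subtype.ext (hu.1.trans he'.symm)]

theorem mem_iff_notMem_of_edge {V : Type} {E : Finset (Sym2 V)} {S : Set V}
    (hS : ∀ e ∈ E, ∃ u v : V, e = s(u, v) ∧ u ∈ S ∧ v ∉ S) {u v : V} (h : s(u, v) ∈ E) :
    u ∈ S ↔ v ∉ S := by
  obtain ⟨x, y, hxy, hx, hy⟩ := hS _ h
  rcases Sym2.eq_iff.1 hxy with ⟨rfl, rfl⟩ | ⟨rfl, rfl⟩ <;> tauto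

/-- Every completely fundamental element of `Φ(Q_G)` has index `1` or `2`; if `G` is
bipartite, every completely fundamental element of `Φ(Q_G)` has index `1`. -/
theorem completelyFundamental_PhiQ_index {V : Type} [Fintype V] [DecidableEq V]
    (E : Finset (Sym2 V)) :
    (∀ a : (↥E → ℕ) × ℕ, CompletelyFundamental (PhiQ E) a → a.2 = 1 ∨ a.2 = 2) ∧
    (IsBipartite E → ∀ a : (↥E → ℕ) × ℕ, CompletelyFundamental (PhiQ E) a → a.2 = 1) := by
  classical
  refine ⟨fun a ha => ?_, fun ⟨S, hS⟩ a ha => ?_⟩ <;>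
    obtain ⟨σ, hσ⟩ := exists_perm_label_pos ha.1 (index_pos_of_ne_zero ha.1 ha.2.1)
  · refine (Nat.dvd_prime Nat.prime_two).1
      (index_dvd_of_permLabel ha hσ (fun u => if u = σ u then 2 else 1) 2 fun v => ?_)
    have h : ∀ u, (if v = u ∨ v = σ u then (if u = σ u then 2 else 1) else 0) =
        (if v = u then 1 else 0) + (if σ.symm v = u then 1 else 0) := fun u => by
      have := σ.symm_apply_eq (x := v) (y := u)
      grind
    simp [h, Finset.sum_add_distrib]
  · refine Nat.dvd_one.1
      (index_dvd_of_permLabel ha hσ (fun u => if u ∈ S then 1 else 0) 1 fun v => ?_)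
    have hside : ∀ u, u ∈ S ↔ σ u ∉ S := fun u => by
      obtain ⟨e, he, -⟩ := hσ u
      exact mem_iff_notMem_of_edge hS (he ▸ e.2)
    have h : ∀ u, (if v = u ∨ v = σ u then (if u ∈ S then 1 else 0) else 0) =
        if (if v ∈ S then v else σ.symm v) = u then 1 else 0 := fun u => by
      have := σ.symm_apply_eq (x := v) (y := u)
      have := hside u
      grind
    simp [h]
end

section
/- Let G be a bipartite graph and let L be a magic labeling of G of index k ≥ 1. Then L can be written as a sum of k magic labelings of G each of index 1 (i.e., as a sum of k indicator labelings of perfect matchings of G). -/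
open Finset

section Multigraph

variable {ι α β : Type*} [Fintype ι] [Fintype α] [DecidableEq α]
  [Fintype β] [DecidableEq β]

/-- Edge weights on a bipartite multigraph (with endpoint maps `a` and `b`) whose sum at every
vertex is `k ≥ 1` have the edge set of a perfect matching in their support. -/
theorem exists_matching_of_sum_fiber_eq (a : ι → α) (b : ι → β) (L : ι → ℕ) {k : ℕ} (hk : 0 < k)
    (ha : ∀ x, ∑ e with a e = x, L e = k) (hb : ∀ y, ∑ e with b e = y, L e = k) :
    ∃ f : α → ι, (∀ x, a (f x) = x) ∧ (∀ x, 0 < L (f x)) ∧ Function.Bijective (b ∘ f) := by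
  have hsum_a (s : Finset α) : ∑ e with a e ∈ s, L e = s.card * k := by
    rw [← Finset.sum_fiberwise_eq_sum_filter]
    simp [ha]
  have hsum_b (s : Finset β) : ∑ e with b e ∈ s, L e = s.card * k := by
    rw [← Finset.sum_fiberwise_eq_sum_filter]
    simp [hb]
  have hcard : Fintype.card α = Fintype.card β := by
    have h := (hsum_a univ).symm.trans ((by simp : _ = _).trans (hsum_b univ))
    exact Nat.eq_of_mul_eq_mul_right hk h
  let t : α → Finset β := fun x ↦ ({e | a e = x ∧ 0 < L e} : Finset ι).image b
  obtain ⟨g, hg, hgt⟩ := (Finset.all_card_le_biUnion_card_iff_exists_injective t).1 fun s ↦ by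
    refine Nat.le_of_mul_le_mul_right ?_ hk
    rw [← hsum_a, ← hsum_b, Finset.sum_filter, Finset.sum_filter]
    refine Finset.sum_le_sum fun e _ ↦ ?_
    split_ifs with h₁ h₂
    · exact le_rfl
    · by_contra! hpos
      exact h₂ (mem_biUnion.2 ⟨a e, h₁, mem_image.2 ⟨e, by simpa using hpos, rfl⟩⟩)
    · exact Nat.zero_le _
    · exact le_rfl
  have hex (x : α) : ∃ e, a e = x ∧ 0 < L e ∧ b e = g x := by
    obtain ⟨e, he, heb⟩ := mem_image.1 (hgt x)
    exact ⟨e, (mem_filter.1 he).2.1, (mem_filter.1 he).2.2, heb⟩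
  choose f hfa hfL hfb using hex
  refine ⟨f, hfa, hfL, ?_⟩
  rw [show b ∘ f = g from funext hfb]
  exact (Fintype.bijective_iff_injective_and_card g).2 ⟨hg, hcard⟩

/-- Edge weights on a bipartite multigraph whose sum at every vertex is `k ≥ 1` dominate edge
weights whose sum at every vertex is `1`. -/
theorem exists_le_sum_fiber_eq_one (a : ι → α) (b : ι → β) (L : ι → ℕ) {k : ℕ} (hk : 0 < k)
    (ha : ∀ x, ∑ e with a e = x, L e = k) (hb : ∀ y, ∑ e with b e = y, L e = k) :
    ∃ M : ι → ℕ, M ≤ L ∧ (∀ x, ∑ e with a e = x, M e = 1) ∧ ∀ y, ∑ e with b e = y, M e = 1 := by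
  classical
  obtain ⟨f, hfa, hfL, hbij⟩ := exists_matching_of_sum_fiber_eq a b L hk ha hb
  refine ⟨fun e ↦ if f (a e) = e then 1 else 0, fun e ↦ ?_, fun x ↦ ?_, fun y ↦ ?_⟩
  · dsimp only
    split_ifs with h
    · exact h ▸ hfL (a e)
    · exact Nat.zero_le _
  · rw [Finset.sum_boole, Nat.cast_id, Finset.card_eq_one]
    refine ⟨f x, ?_⟩
    ext e
    grind
  · obtain ⟨x, hx⟩ := hbij.2 y
    have hinj := hbij.1
    rw [Finset.sum_boole, Nat.cast_id, Finset.card_eq_one]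
    refine ⟨f x, ?_⟩
    ext e
    simp only [mem_filter, mem_univ, true_and, mem_singleton]
    constructor
    · rintro ⟨h₁, h₂⟩
      have : a e = x := hinj (by simp only [Function.comp_apply] at hx ⊢; rw [h₂, h₁, hx])
      rw [← h₂, this]
    · rintro rfl
      exact ⟨hx, by rw [hfa]⟩

/-- Edge weights on a bipartite multigraph whose sum at every vertex is `k` are a sum of `k`
edge weights whose sum at every vertex is `1`. -/
theorem exists_decomposition_of_sum_fiber_eq (a : ι → α) (b : ι → β) (k : ℕ) (L : ι → ℕ)
    (ha : ∀ x, ∑ e with a e = x, L e = k) (hb : ∀ y, ∑ e with b e = y, L e = k) :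
    ∃ M : Fin k → ι → ℕ, (∀ j, (∀ x, ∑ e with a e = x, M j e = 1) ∧
      ∀ y, ∑ e with b e = y, M j e = 1) ∧ ∀ e, L e = ∑ j, M j e := by
  induction k generalizing L with
  | zero =>
    refine ⟨fun _ _ ↦ 0, fun j ↦ j.elim0, fun e ↦ ?_⟩
    simpa using Finset.sum_eq_zero_iff.1 (ha (a e)) e (by simp)
  | succ k ih =>
    obtain ⟨M, hML, hMa, hMb⟩ := exists_le_sum_fiber_eq_one a b L k.succ_pos ha hb
    obtain ⟨N, hN, hNL⟩ := ih (fun e ↦ L e - M e)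
      (fun x ↦ by rw [Finset.sum_tsub_distrib _ fun e _ ↦ hML e, ha, hMa, Nat.add_sub_cancel])
      (fun y ↦ by rw [Finset.sum_tsub_distrib _ fun e _ ↦ hML e, hb, hMb, Nat.add_sub_cancel])
    refine ⟨Fin.cons M N, Fin.cases ⟨hMa, hMb⟩ hN, fun e ↦ ?_⟩
    rw [Fin.sum_univ_succ]
    simp only [Fin.cons_zero, Fin.cons_succ, ← hNL]
    exact (Nat.add_sub_cancel' (hML e)).symm

end Multigraph

theorem vsum_eq_sum_filter {V : Type} [DecidableEq V] (E : Finset (Sym2 V)) (L : E → ℕ) (v : V) :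
    vsum E L v = ∑ e : E with v ∈ e.1, L e := by
  rw [vsum, Finset.sum_filter, Finset.univ_eq_attach]

/-- Every magic labeling of a bipartite graph of index `k ≥ 1` is a sum of `k` magic
labelings of index `1` (indicator labelings of perfect matchings). -/
theorem bipartite_magic_decomposition {V : Type} [Fintype V] [DecidableEq V]
    (E : Finset (Sym2 V)) (hbip : IsBipartite E)
    (L : ↥E → ℕ) (k : ℕ) (hk : 1 ≤ k) (hL : ∀ v : V, vsum E L v = k) :
    ∃ M : Fin k → (↥E → ℕ),
      (∀ j, ∀ v : V, vsum E (M j) v = 1) ∧ (∀ e, L e = ∑ j, M j e) := by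
  classical
  obtain ⟨S, hS⟩ := hbip
  choose a b hab haS hbS using fun e : E ↦ hS e.1 e.2
  let a' : E → {v // v ∈ S} := fun e ↦ ⟨a e, haS e⟩
  let b' : E → {v // v ∉ S} := fun e ↦ ⟨b e, hbS e⟩
  have hvsum_a (N : E → ℕ) (x : {v // v ∈ S}) :
      vsum E N x = ∑ e with a' e = x, N e := by
    rw [vsum_eq_sum_filter]
    refine Finset.sum_congr (Finset.filter_congr fun e _ ↦ ?_) fun _ _ ↦ rfl
    have hne : (x : V) ≠ b e := fun h ↦ hbS e (h ▸ x.2)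
    rw [hab e, Sym2.mem_iff, Subtype.ext_iff]
    simp [a', hne, eq_comm]
  have hvsum_b (N : E → ℕ) (y : {v // v ∉ S}) :
      vsum E N y = ∑ e with b' e = y, N e := by
    rw [vsum_eq_sum_filter]
    refine Finset.sum_congr (Finset.filter_congr fun e _ ↦ ?_) fun _ _ ↦ rfl
    have hne : (y : V) ≠ a e := fun h ↦ y.2 (h ▸ haS e)
    rw [hab e, Sym2.mem_iff, Subtype.ext_iff]
    simp [b', hne, eq_comm]
  obtain ⟨M, hM, hML⟩ := exists_decomposition_of_sum_fiber_eq a' b' k L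
    (fun x ↦ by rw [← hvsum_a, hL]) (fun y ↦ by rw [← hvsum_b, hL])
  refine ⟨M, fun j v ↦ ?_, hML⟩
  by_cases hv : v ∈ S
  · exact (hvsum_a (M j) ⟨v, hv⟩).trans ((hM j).1 _)
  · exact (hvsum_b (M j) ⟨v, hv⟩).trans ((hM j).2 _)
end

section
/- Let n ≥ 2 and p ≥ 1 be integers, and let G_{n,p} be the graph obtained from two vertices x and y by joining them with n internally disjoint paths each of length 2p+1 (so G_{n,1} = G_n). Then M_{G_{n,p}}(k) = M_{G_n}(k) for all k ∈ ℕ. -/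
open Finset

/-- Vertices of the graph `G n`: `Sum.inl i` is `aᵢ`, `Sum.inr (Sum.inl i)` is `bᵢ`,
`Sum.inr (Sum.inr false)` is `x`, and `Sum.inr (Sum.inr true)` is `y`. -/
abbrev Vn (n : ℕ) := Fin n ⊕ Fin n ⊕ Bool

def va {n : ℕ} (i : Fin n) : Vn n := Sum.inl i
def vb {n : ℕ} (i : Fin n) : Vn n := Sum.inr (Sum.inl i)
def vx {n : ℕ} : Vn n := Sum.inr (Sum.inr false)
def vy {n : ℕ} : Vn n := Sum.inr (Sum.inr true)

/-- The edge set of the graph `Gₙ`: edges `aᵢbᵢ`, `x aᵢ` and `y bᵢ` for `1 ≤ i ≤ n`. -/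
def Gedges (n : ℕ) : Finset (Sym2 (Vn n)) :=
  (Finset.univ.image fun i : Fin n => s(va i, vb i)) ∪
  (Finset.univ.image fun i : Fin n => s(vx, va i)) ∪
  (Finset.univ.image fun i : Fin n => s(vy, vb i))

/-- Vertices of `G_{n,p}`: `Sum.inl false` is `x`, `Sum.inl true` is `y`, and
`Sum.inr (i, j)` is the `(j+1)`-st internal vertex `v⁽ⁱ⁾_{j+1}` of the `i`-th path. -/
abbrev Vnp (n p : ℕ) := Bool ⊕ (Fin n × Fin (2 * p))

def vX {n p : ℕ} : Vnp n p := Sum.inl false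
def vY {n p : ℕ} : Vnp n p := Sum.inl true
def vmid {n p : ℕ} (i : Fin n) (j : Fin (2 * p)) : Vnp n p := Sum.inr (i, j)

/-- The successor of `j` in `Fin m` (used only below the top index). -/
def finNext {m : ℕ} (j : Fin m) : Fin m :=
  ⟨(j.val + 1) % m, Nat.mod_lt _ (Nat.lt_of_le_of_lt (Nat.zero_le _) j.isLt)⟩

/-- The edge set of `G_{n,p}`: `n` internally disjoint paths of length `2p + 1`
from `x` to `y`: edges `x v⁽ⁱ⁾₁`, `v⁽ⁱ⁾ⱼ v⁽ⁱ⁾ⱼ₊₁` for `1 ≤ j ≤ 2p - 1`,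
and `v⁽ⁱ⁾₂ₚ y`. -/
def Gnpedges (n p : ℕ) : Finset (Sym2 (Vnp n p)) :=
  (((Finset.univ : Finset (Fin n × Fin (2 * p))).filter fun q => q.2.val = 0).image
      fun q => s(vX, vmid q.1 q.2)) ∪
  (((Finset.univ : Finset (Fin n × Fin (2 * p))).filter fun q => q.2.val + 1 < 2 * p).image
      fun q => s(vmid q.1 q.2, vmid q.1 (finNext q.2))) ∪
  (((Finset.univ : Finset (Fin n × Fin (2 * p))).filter fun q => q.2.val = 2 * p - 1).image
      fun q => s(vmid q.1 q.2, vY))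

/-- `E` is the edge set of a graph on `V` which is a union of `n` internally disjoint paths
`φ i 0, …, φ i (2 * p + 1)` with common end points. -/
structure IsPathUnion {V : Type} (n p : ℕ) (φ : Fin n → ℕ → V) (E : Finset (Sym2 V)) :
    Prop where
  mem_edges : ∀ e, e ∈ E ↔ ∃ i, ∃ j < 2 * p + 1, s(φ i j, φ i (j + 1)) = e
  vertex_eq_iff : ∀ i i' j j', j ≤ 2 * p + 1 → j' ≤ 2 * p + 1 →
    (φ i j = φ i' j' ↔ j = j' ∧ (i = i' ∨ j = 0 ∨ j = 2 * p + 1))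
  exists_vertex : ∀ v, ∃ i, ∃ j ≤ 2 * p + 1, φ i j = v

namespace IsPathUnion

variable {V : Type} {n p : ℕ} {φ : Fin n → ℕ → V} {E : Finset (Sym2 V)}

/-- The edge of index `j` on the path of index `i`. -/
def edge (h : IsPathUnion n p φ E) (q : Fin n × Fin (2 * p + 1)) : E :=
  ⟨s(φ q.1 q.2, φ q.1 (q.2 + 1)), (h.mem_edges _).2 ⟨q.1, q.2, q.2.isLt, rfl⟩⟩

lemma edge_bijective (h : IsPathUnion n p φ E) (hp : 1 ≤ p) : Function.Bijective h.edge := by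
  constructor
  · rintro ⟨i, j, hj⟩ ⟨i', j', hj'⟩ heq
    have h1 := congrArg Subtype.val heq
    simp only [edge, Sym2.eq_iff] at h1
    rw [h.vertex_eq_iff _ _ _ _ (by omega) (by omega),
      h.vertex_eq_iff _ _ _ _ (by omega) (by omega),
      h.vertex_eq_iff _ _ _ _ (by omega) (by omega),
      h.vertex_eq_iff _ _ _ _ (by omega) (by omega)] at h1
    simp only [Prod.mk.injEq, Fin.mk.injEq]
    rcases h1 with ⟨⟨h1, h2⟩, -, h3⟩ | ⟨⟨h1, -⟩, h2, -⟩
    · refine ⟨?_, h1⟩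
      rcases h2 with h2 | h2 | h2
      · exact h2
      · rcases h3 with h3 | h3
        · exact h3
        · omega
      · omega
    · omega
  · rintro ⟨e, he⟩
    obtain ⟨i, j, hj, rfl⟩ := (h.mem_edges e).1 he
    exact ⟨(i, ⟨j, hj⟩), rfl⟩

/-- The parametrization of the edges by path and position. -/
noncomputable def edgeEquiv (h : IsPathUnion n p φ E) (hp : 1 ≤ p) :
    Fin n × Fin (2 * p + 1) ≃ E :=
  Equiv.ofBijective _ (h.edge_bijective hp)

lemma mem_edge_iff (h : IsPathUnion n p φ E) (hp : 1 ≤ p) (i : Fin n) {j : ℕ}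
    (hj : j ≤ 2 * p + 1) (q : Fin n × Fin (2 * p + 1)) :
    φ i j ∈ (h.edgeEquiv hp q).1 ↔
      (j = q.2 ∧ (i = q.1 ∨ j = 0)) ∨ (j = q.2 + 1 ∧ (i = q.1 ∨ j = 2 * p + 1)) := by
  have hq := q.2.isLt
  change φ i j ∈ s(φ q.1 q.2, φ q.1 (q.2 + 1)) ↔ _
  rw [Sym2.mem_iff, h.vertex_eq_iff _ _ _ _ hj (by omega),
    h.vertex_eq_iff _ _ _ _ hj (by omega)]
  grind

variable [DecidableEq V]

lemma vsum_eq_sum (h : IsPathUnion n p φ E) (hp : 1 ≤ p) (L : E → ℕ) (v : V) :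
    vsum E L v =
      ∑ q, if v ∈ (h.edgeEquiv hp q).1 then L (h.edgeEquiv hp q) else 0 := by
  rw [(h.edgeEquiv hp).sum_comp (fun e : E => if v ∈ e.1 then L e else 0)]
  rfl

lemma vsum_start (h : IsPathUnion n p φ E) (hp : 1 ≤ p) (L : E → ℕ) (i : Fin n) :
    vsum E L (φ i 0) = ∑ i', L (h.edgeEquiv hp (i', 0)) := by
  rw [h.vsum_eq_sum hp, Fintype.sum_prod_type]
  refine Finset.sum_congr rfl fun i' _ => ?_
  rw [Finset.sum_eq_single 0]
  · rw [if_pos ((h.mem_edge_iff hp i (by omega) _).2 (by simp))]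
  · intro j _ hj
    rw [if_neg]
    rw [h.mem_edge_iff hp i (by omega)]
    have : (j : ℕ) ≠ 0 := fun hj' => hj (Fin.ext hj')
    simp only
    omega
  · simp

lemma vsum_end (h : IsPathUnion n p φ E) (hp : 1 ≤ p) (L : E → ℕ) (i : Fin n) :
    vsum E L (φ i (2 * p + 1)) = ∑ i', L (h.edgeEquiv hp (i', Fin.last _)) := by
  rw [h.vsum_eq_sum hp, Fintype.sum_prod_type]
  refine Finset.sum_congr rfl fun i' _ => ?_
  rw [Finset.sum_eq_single (Fin.last _)]
  · rw [if_pos ((h.mem_edge_iff hp i (by omega) _).2 (by simp))]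
  · intro j _ hj
    rw [if_neg]
    rw [h.mem_edge_iff hp i (by omega)]
    have : (j : ℕ) ≠ 2 * p := fun hj' => hj (Fin.ext hj')
    have := j.isLt
    simp only
    omega
  · simp

lemma vsum_internal (h : IsPathUnion n p φ E) (hp : 1 ≤ p) (L : E → ℕ) (i : Fin n)
    (j : Fin (2 * p)) :
    vsum E L (φ i (j + 1)) =
      L (h.edgeEquiv hp (i, j.castSucc)) + L (h.edgeEquiv hp (i, j.succ)) := by
  have hj := j.isLt
  rw [h.vsum_eq_sum hp, Fintype.sum_eq_add (i, j.castSucc) (i, j.succ)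
    (by simp [Fin.ext_iff]), if_pos, if_pos]
  · exact (h.mem_edge_iff hp i (by omega) _).2 (by simp)
  · exact (h.mem_edge_iff hp i (by omega) _).2 (by simp)
  · rintro ⟨i', j'⟩ ⟨h1, h2⟩
    rw [if_neg]
    rw [h.mem_edge_iff hp i (by omega)]
    simp only [ne_eq, Prod.mk.injEq, Fin.ext_iff, Fin.val_castSucc, Fin.val_succ] at h1 h2 ⊢
    omega

/-- A labeling is magic iff it alternates along each path between `u i` and `s - u i`, where
`u i` is the label of the first edge and `s` is the sum of the `u i`. -/
lemma isMagic_iff (h : IsPathUnion n p φ E) (hp : 1 ≤ p) (L : E → ℕ) :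
    IsMagic E L ↔ ∀ i j, L (h.edgeEquiv hp (i, j)) =
      if Even (j : ℕ) then L (h.edgeEquiv hp (i, 0))
      else ∑ i', L (h.edgeEquiv hp (i', 0)) - L (h.edgeEquiv hp (i, 0)) := by
  constructor
  · intro hL i j
    induction j using Fin.induction with
    | zero => simp
    | succ j ih =>
      have h1 := hL (φ i (j + 1)) (φ i 0)
      rw [h.vsum_internal hp, h.vsum_start hp, ih] at h1
      have h2 : L (h.edgeEquiv hp (i, 0)) ≤ ∑ i', L (h.edgeEquiv hp (i', 0)) :=
        Finset.single_le_sum (f := fun i' => L (h.edgeEquiv hp (i', 0)))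
          (fun _ _ => Nat.zero_le _) (Finset.mem_univ i)
      simp only [Fin.val_castSucc, Fin.val_succ, Nat.even_add_one] at h1 ⊢
      split_ifs at h1 ⊢ <;> first | contradiction | omega
  · intro hL
    suffices H : ∀ v, vsum E L v = ∑ i', L (h.edgeEquiv hp (i', 0)) from
      fun v w => (H v).trans (H w).symm
    intro v
    obtain ⟨i, j, hj, rfl⟩ := h.exists_vertex v
    obtain rfl | hj0 := Nat.eq_zero_or_pos j
    · exact h.vsum_start hp L i
    obtain rfl | hj1 := hj.eq_or_lt
    · rw [h.vsum_end hp]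
      exact Finset.sum_congr rfl fun i' _ => by rw [hL i' (Fin.last _), if_pos (by simp)]
    · obtain ⟨j, rfl⟩ := Nat.exists_eq_add_of_le' hj0
      have h2 : L (h.edgeEquiv hp (i, 0)) ≤ ∑ i', L (h.edgeEquiv hp (i', 0)) :=
        Finset.single_le_sum (f := fun i' => L (h.edgeEquiv hp (i', 0)))
          (fun _ _ => Nat.zero_le _) (Finset.mem_univ i)
      rw [h.vsum_internal hp L i ⟨j, by omega⟩, hL i (Fin.castSucc _), hL i (Fin.succ _)]
      simp only [Fin.val_castSucc, Fin.val_succ, Nat.even_add_one]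
      split_ifs <;> omega

/-- The number of magic `k`-labelings does not depend on the length of the paths. -/
lemma magicCount_eq (h : IsPathUnion n p φ E) (hp : 1 ≤ p) (k : ℕ) :
    magicCount E k = Set.ncard {u : Fin n → ℕ | ∀ i, u i ≤ k ∧ ∑ i', u i' - u i ≤ k} := by
  refine Set.ncard_congr (fun L _ i => L (h.edgeEquiv hp (i, 0))) ?_ ?_ ?_
  · rintro L ⟨hL, hk⟩ i
    refine ⟨hk _, ?_⟩
    have h1 := (h.isMagic_iff hp L).1 hL i ⟨1, by omega⟩
    rw [if_neg (by simp)] at h1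
    exact h1 ▸ hk _
  · rintro L L' ⟨hL, -⟩ ⟨hL', -⟩ heq
    have heq' (i) : L (h.edgeEquiv hp (i, 0)) = L' (h.edgeEquiv hp (i, 0)) := congrFun heq i
    ext e
    obtain ⟨⟨i, j⟩, rfl⟩ := (h.edgeEquiv hp).surjective e
    rw [(h.isMagic_iff hp L).1 hL, (h.isMagic_iff hp L').1 hL']
    simp only [heq']
  · intro u hu
    refine ⟨fun e => if Even (((h.edgeEquiv hp).symm e).2 : ℕ)
      then u ((h.edgeEquiv hp).symm e).1
      else ∑ i', u i' - u ((h.edgeEquiv hp).symm e).1, ⟨?_, fun e => ?_⟩, ?_⟩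
    · rw [h.isMagic_iff hp]
      simp
    · dsimp only
      split_ifs
      exacts [(hu _).1, (hu _).2]
    · simp

end IsPathUnion

/-- The vertex at position `j` on the path `x, v⁽ⁱ⁾₁, …, v⁽ⁱ⁾₂ₚ, y`. -/
def pathVertexGnp {n p : ℕ} (i : Fin n) (j : ℕ) : Vnp n p :=
  if j = 0 then vX else if hj : j - 1 < 2 * p then vmid i ⟨j - 1, hj⟩ else vY

/-- The vertex at position `j` on the path `x, aᵢ, bᵢ, y`. -/
def pathVertexGn {n : ℕ} (i : Fin n) (j : ℕ) : Vn n :=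
  if j = 0 then vx else if j = 1 then va i else if j = 2 then vb i else vy

lemma isPathUnion_Gnp {n p : ℕ} (hn : 0 < n) (hp : 1 ≤ p) :
    IsPathUnion n p pathVertexGnp (Gnpedges n p) where
  mem_edges e := by
    simp only [Gnpedges, mem_union, mem_image, mem_filter, mem_univ, true_and, Prod.exists]
    constructor
    · rintro ((⟨i, j, hj, rfl⟩ | ⟨i, j, hj, rfl⟩) | ⟨i, j, hj, rfl⟩)
      · refine ⟨i, 0, by omega, ?_⟩
        have : j = ⟨0, by omega⟩ := Fin.ext hj
        have h2 : 0 < 2 * p := by omega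
        simp [pathVertexGnp, this, h2]
      · refine ⟨i, j + 1, by omega, ?_⟩
        simp [pathVertexGnp, hj, finNext, Nat.mod_eq_of_lt hj]
      · refine ⟨i, 2 * p, by omega, ?_⟩
        have : j = ⟨2 * p - 1, by omega⟩ := Fin.ext hj
        have h2 : 0 < p := by omega
        simp [pathVertexGnp, this, h2, h2.ne']
    · rintro ⟨i, j, hj, rfl⟩
      obtain rfl | hj0 := Nat.eq_zero_or_pos j
      · refine Or.inl (Or.inl ⟨i, ⟨0, by omega⟩, rfl, ?_⟩)
        have h2 : 0 < 2 * p := by omega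
        simp [pathVertexGnp, h2]
      obtain ⟨j, rfl⟩ := Nat.exists_eq_add_of_le' hj0
      by_cases hj1 : j + 1 < 2 * p
      · refine Or.inl (Or.inr ⟨i, ⟨j, by omega⟩, hj1, ?_⟩)
        have h2 : j < 2 * p := by omega
        simp [pathVertexGnp, hj1, finNext, Nat.mod_eq_of_lt hj1, h2]
      · refine Or.inr ⟨i, ⟨j, by omega⟩, by simp only; omega, ?_⟩
        have h2 : j < 2 * p := by omega
        simp [pathVertexGnp, hj1, h2]
  vertex_eq_iff i i' j j' hj hj' := by
    unfold pathVertexGnp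
    split_ifs <;> simp [vX, vY, vmid] <;> omega
  exists_vertex v := by
    rcases v with (_ | _) | ⟨i, j⟩
    · exact ⟨⟨0, hn⟩, 0, by omega, by simp [pathVertexGnp, vX]⟩
    · exact ⟨⟨0, hn⟩, 2 * p + 1, le_rfl, by simp [pathVertexGnp, vY]⟩
    · exact ⟨i, j + 1, by omega, by simp [pathVertexGnp, vmid]⟩

lemma isPathUnion_Gn {n : ℕ} (hn : 0 < n) :
    IsPathUnion n 1 pathVertexGn (Gedges n) where
  mem_edges e := by
    simp only [Gedges, mem_union, mem_image, mem_univ, true_and]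
    constructor
    · rintro ((⟨i, rfl⟩ | ⟨i, rfl⟩) | ⟨i, rfl⟩)
      · exact ⟨i, 1, by omega, by simp [pathVertexGn]⟩
      · exact ⟨i, 0, by omega, by simp [pathVertexGn]⟩
      · exact ⟨i, 2, by omega, by simp [pathVertexGn, Sym2.eq_swap]⟩
    · rintro ⟨i, j, hj, rfl⟩
      interval_cases j
      · exact Or.inl (Or.inr ⟨i, by simp [pathVertexGn]⟩)
      · exact Or.inl (Or.inl ⟨i, by simp [pathVertexGn]⟩)
      · exact Or.inr ⟨i, by simp [pathVertexGn, Sym2.eq_swap]⟩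
  vertex_eq_iff i i' j j' hj hj' := by
    unfold pathVertexGn
    split_ifs <;> simp [vx, vy, va, vb] <;> omega
  exists_vertex v := by
    rcases v with i | i | _ | _
    · exact ⟨i, 1, by omega, by simp [pathVertexGn, va]⟩
    · exact ⟨i, 2, by omega, by simp [pathVertexGn, vb]⟩
    · exact ⟨⟨0, hn⟩, 0, by omega, by simp [pathVertexGn, vx]⟩
    · exact ⟨⟨0, hn⟩, 3, by omega, by simp [pathVertexGn, vy]⟩

/-- `M_{G_{n,p}}(k) = M_{Gₙ}(k)` for all `k`. -/
theorem magicCount_Gnp_eq_Gn (n p : ℕ) (hn : 2 ≤ n) (hp : 1 ≤ p) (k : ℕ) :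
    magicCount (Gnpedges n p) k = magicCount (Gedges n) k := by
  rw [(isPathUnion_Gnp (by omega) hp).magicCount_eq hp,
    (isPathUnion_Gn (by omega)).magicCount_eq le_rfl]
end
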